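/- Let 2 ≤ h ≤ d and consider an (n,d)-multi-labeling of the h-graph. Call a k-element subset S ⊆ {1,…,d} an occurring unordered d-vertex label if S = range(J_s) for some s ∈ ℤ/hℤ, and call an occurring S bad if there exists a ∈ {1,…,n} for which Σ_{s ∈ ℤ/hℤ} 1{range(J_s) = S}·(1{i_s = a} + 1{i_{s+1} = a}) is odd. Then the number of bad occurring unordered d-vertex labels is at most 48·Δ. -/

import Mathlib

/-!
Bound on the number of bad unordered `d`-vertex labels of an `(n,d)`-multi-labeling
(Lemma "num_badvertex_bd").
-/

noncomputable section

/-- The number of edges between `d`-vertices carrying the `d`-label `j` and `n`-vertices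
carrying the `n`-label `a` in the cyclic `h`-graph. -/
def edgeCount {h k n d : ℕ} [NeZero h] (idx : ZMod h → Fin n) (lbl : ZMod h → Fin k → Fin d)
    (a : Fin n) (j : Fin d) : ℕ :=
  ∑ s : ZMod h, (if ∃ b, lbl s b = j then 1 else 0) *
    ((if idx s = a then 1 else 0) + (if idx (s + 1) = a then 1 else 0))

/-- An `(n,d)`-multi-labeling of the `h`-graph: `n`-labels `i_s` and injective ordered
`d`-vertex labels `J_s` around the `2h`-cycle, with `i_s ≠ i_{s+1}` and all edge counts
`b_{a,j}` even. -/
structure MultiLabeling (h k n d : ℕ) [NeZero h] where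
  /-- `n`-labels of the `n`-vertices. -/
  idx : ZMod h → Fin n
  /-- Ordered `d`-vertex labels (injective `k`-tuples with entries in `Fin d`). -/
  lbl : ZMod h → Fin k → Fin d
  lbl_inj : ∀ s, Function.Injective (lbl s)
  idx_ne : ∀ s, idx s ≠ idx (s + 1)
  even_edge : ∀ a j, Even (edgeCount idx lbl a j)

variable {h k n d : ℕ} [NeZero h]

/-- `r_n`: the number of distinct `n`-labels. -/
def rn (L : MultiLabeling h k n d) : ℕ := (Finset.univ.image L.idx).card

/-- `r_d`: the number of distinct `d`-labels. -/
def rd (L : MultiLabeling h k n d) : ℕ :=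
  (Finset.univ.biUnion fun s => Finset.univ.image (L.lbl s)).card

/-- `Δ = k(h+1) − (k r_n + r_d)`. -/
def Δlab (L : MultiLabeling h k n d) : ℤ :=
  (k : ℤ) * (h + 1) - ((k : ℤ) * rn L + rd L)

/-- The number of edges between `d`-vertices carrying the unordered `d`-vertex label `S` and
`n`-vertices carrying the `n`-label `a`. -/
def unorderedLabelEdgeCount (L : MultiLabeling h k n d) (S : Finset (Fin d)) (a : Fin n) : ℕ :=
  ∑ s : ZMod h, (if Finset.image (L.lbl s) Finset.univ = S then 1 else 0) *
    ((if L.idx s = a then 1 else 0) + (if L.idx (s + 1) = a then 1 else 0))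

section ClosedWalk

variable (idx : ZMod h → Fin n)

/-- The degree of the vertex `a` in the multigraph formed by the steps `s ∈ H` of the closed walk
`idx`, where step `s` joins `idx s` and `idx (s + 1)`. -/
def stepDegree (H : Finset (ZMod h)) (a : Fin n) : ℕ :=
  ∑ s ∈ H, ((if idx s = a then 1 else 0) + (if idx (s + 1) = a then 1 else 0))

/-- The steps of the closed walk `idx` arriving at a vertex not visited before; they form a
spanning tree of the visited vertices. -/
def treeSteps : Finset (ZMod h) :=
  Finset.univ.filter fun s => ∀ t : ZMod h, t.val ≤ s.val → idx t ≠ idx (s + 1)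

variable {idx}

lemma mem_treeSteps {s : ZMod h} :
    s ∈ treeSteps idx ↔ ∀ t : ZMod h, t.val ≤ s.val → idx t ≠ idx (s + 1) := by
  simp [treeSteps]

lemma val_add_one_of_val_lt {s t : ZMod h} (hst : s.val < t.val) :
    (s + 1).val = s.val + 1 := by
  have ht := ZMod.val_lt t
  have h1 : (1 : ZMod h).val = 1 := by
    have : Fact (1 < h) := ⟨by omega⟩
    exact ZMod.val_one h
  rw [ZMod.val_add_of_lt, h1]
  rw [h1]
  omega

omit [NeZero h] in
lemma sum_stepDegree (H : Finset (ZMod h)) : ∑ a, stepDegree idx H a = 2 * H.card := by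
  unfold stepDegree
  rw [Finset.sum_comm]
  simp [Finset.sum_add_distrib, mul_comm]

omit [NeZero h] in
lemma stepDegree_pos {H : Finset (ZMod h)} {s : ZMod h} {a : Fin n} (hs : s ∈ H)
    (ha : idx (s + 1) = a) : 0 < stepDegree idx H a :=
  Finset.sum_pos' (fun _ _ => Nat.zero_le _) ⟨s, hs, by simp [ha]⟩

lemma eq_empty_of_subset_treeSteps {H : Finset (ZMod h)} (hH : ∀ a, Even (stepDegree idx H a))
    (hT : H ⊆ treeSteps idx) : H = ∅ := by
  by_contra hne
  obtain ⟨s, hs, hmax⟩ := H.exists_max_image ZMod.val (Finset.nonempty_iff_ne_empty.mpr hne)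
  have hsT := mem_treeSteps.mp (hT hs)
  have hdeg : stepDegree idx H (idx (s + 1)) = 1 := by
    unfold stepDegree
    rw [Finset.sum_eq_single_of_mem s hs]
    · simp [hsT s le_rfl]
    · intro t ht hts
      have hlt : t.val < s.val :=
        lt_of_le_of_ne (hmax t ht) fun e => hts (ZMod.val_injective h e)
      have hsucc := val_add_one_of_val_lt hlt
      simp [hsT t hlt.le, hsT (t + 1) (by omega)]
  have := hH (idx (s + 1))
  rw [hdeg] at this
  exact Nat.not_even_one this

omit [NeZero h] in
lemma stepDegree_symmDiff (A B : Finset (ZMod h)) (a : Fin n) :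
    stepDegree idx (symmDiff A B) a + 2 * stepDegree idx (A ∩ B) a =
      stepDegree idx A a + stepDegree idx B a := by
  unfold stepDegree
  rw [symmDiff_def, Finset.sup_eq_union, Finset.sum_union disjoint_sdiff_sdiff]
  rw [← Finset.sum_inter_add_sum_sdiff A B, ← Finset.sum_inter_add_sum_sdiff B A,
    Finset.inter_comm B A]
  ring

lemma eq_of_sdiff_treeSteps_eq {A B : Finset (ZMod h)} (hA : ∀ a, Even (stepDegree idx A a))
    (hB : ∀ a, Even (stepDegree idx B a)) (hAB : A \ treeSteps idx = B \ treeSteps idx) :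
    A = B := by
  rw [← symmDiff_eq_bot]
  apply eq_empty_of_subset_treeSteps (idx := idx)
  · intro a
    have h1 := stepDegree_symmDiff (idx := idx) A B a
    have h2 := hA a
    have h3 := hB a
    grind
  · intro s hs
    by_contra hsT
    have : s ∈ A \ treeSteps idx ↔ s ∈ B \ treeSteps idx := by rw [hAB]
    simp only [Finset.mem_sdiff, hsT, not_false_eq_true, and_true] at this
    rw [Finset.mem_symmDiff] at hs
    tauto

lemma injOn_treeSteps : Set.InjOn (fun s => idx (s + 1)) (treeSteps idx : Set (ZMod h)) := by
  have key : ∀ s ∈ treeSteps idx, ∀ t ∈ treeSteps idx, s.val < t.val →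
      idx (s + 1) ≠ idx (t + 1) := by
    intro s _ t ht hlt
    have := val_add_one_of_val_lt hlt
    exact mem_treeSteps.mp ht (s + 1) (by omega)
  intro s hs t ht hst
  rcases lt_trichotomy s.val t.val with hlt | he | hlt
  · exact absurd hst (key s hs t ht hlt)
  · exact ZMod.val_injective h he
  · exact absurd hst.symm (key t ht s hs hlt)

lemma card_image_le_card_treeSteps :
    (Finset.univ.image idx).card ≤ (treeSteps idx).card + 1 := by
  have hsub : Finset.univ.image idx ⊆
      insert (idx 0) ((treeSteps idx).image fun s => idx (s + 1)) := by
    intro a ha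
    obtain ⟨s₀, -, hs₀⟩ := Finset.mem_image.mp ha
    obtain ⟨s, hs, hmin⟩ := (Finset.univ.filter fun s => idx s = a).exists_min_image ZMod.val
      ⟨s₀, by simp [hs₀]⟩
    simp only [Finset.mem_filter, Finset.mem_univ, true_and] at hs hmin
    by_cases h0 : s = 0
    · simp [← hs, h0]
    · refine Finset.mem_insert_of_mem (Finset.mem_image.mpr ⟨s - 1, ?_, by simp [hs]⟩)
      rw [mem_treeSteps]
      intro t ht he
      rw [sub_add_cancel, hs] at he
      have h1 := hmin t he
      have h2 : s.val ≠ 0 := by simpa [ZMod.val_eq_zero] using h0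
      have h3 := ZMod.val_lt s
      have h4 : (1 : ZMod h).val = 1 := by
        have : Fact (1 < h) := ⟨by omega⟩
        exact ZMod.val_one h
      rw [ZMod.val_sub (by omega), h4] at ht
      omega
  exact (Finset.card_le_card hsub).trans
    ((Finset.card_insert_le _ _).trans (by gcongr; exact Finset.card_image_le))

lemma card_le_card_support_add (H : Finset (ZMod h)) :
    H.card ≤ (Finset.univ.filter fun a => 0 < stepDegree idx H a).card +
      (H \ treeSteps idx).card := by
  rw [← Finset.card_inter_add_card_sdiff H (treeSteps idx)]
  gcongr
  refine Finset.card_le_card_of_injOn (fun s => idx (s + 1)) ?_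
    (injOn_treeSteps.mono (by simp))
  intro s hs
  simpa using stepDegree_pos (Finset.mem_of_mem_inter_left hs) rfl

end ClosedWalk

namespace MultiLabeling

variable (L : MultiLabeling h k n d)

/-- The unordered label of the `d`-vertex at step `s`. -/
def label (s : ZMod h) : Finset (Fin d) := Finset.image (L.lbl s) Finset.univ

/-- The steps whose label contains `j`. -/
def stepsThrough (j : Fin d) : Finset (ZMod h) := Finset.univ.filter fun s => j ∈ L.label s

/-- The steps whose unordered label is `S`. -/
def stepsLabeled (S : Finset (Fin d)) : Finset (ZMod h) :=
  Finset.univ.filter fun s => L.label s = S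

/-- The unordered labels having odd degree at `a`. -/
def oddLabels (a : Fin n) : Finset (Finset (Fin d)) :=
  Finset.univ.filter fun S => ¬ Even (stepDegree L.idx (L.stepsLabeled S) a)

/-- The unordered labels having odd degree at some vertex. -/
def badLabels : Finset (Finset (Fin d)) := Finset.univ.biUnion L.oddLabels

/-- The steps carrying a bad unordered label. -/
def badSteps : Finset (ZMod h) := Finset.univ.filter fun s => L.label s ∈ L.badLabels

variable {L}

lemma card_label (s : ZMod h) : (L.label s).card = k := by
  simp [label, Finset.card_image_of_injective _ (L.lbl_inj s)]

lemma mem_oddLabels {S : Finset (Fin d)} {a : Fin n} :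
    S ∈ L.oddLabels a ↔ ¬ Even (stepDegree L.idx (L.stepsLabeled S) a) := by
  simp [oddLabels]

lemma unorderedLabelEdgeCount_eq (S : Finset (Fin d)) (a : Fin n) :
    unorderedLabelEdgeCount L S a = stepDegree L.idx (L.stepsLabeled S) a := by
  unfold unorderedLabelEdgeCount stepDegree stepsLabeled label
  rw [Finset.sum_filter]
  simp only [ite_mul, one_mul, zero_mul]

lemma even_stepDegree_stepsThrough (j : Fin d) (a : Fin n) :
    Even (stepDegree L.idx (L.stepsThrough j) a) := by
  have := L.even_edge a j
  simpa [edgeCount, stepDegree, stepsThrough, label, Finset.sum_filter] using this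

lemma stepDegree_filter_label (B : Finset (Finset (Fin d))) (a : Fin n) :
    stepDegree L.idx (Finset.univ.filter fun s => L.label s ∈ B) a =
      ∑ S ∈ B, stepDegree L.idx (L.stepsLabeled S) a := by
  unfold stepDegree
  rw [← Finset.sum_fiberwise_of_maps_to (t := B) (g := L.label) (by simp)]
  refine Finset.sum_congr rfl fun S hS => Finset.sum_congr ?_ fun _ _ => rfl
  ext s
  simp only [stepsLabeled, Finset.mem_filter, Finset.mem_univ, true_and]
  exact ⟨fun hs => hs.2, fun hs => ⟨hs ▸ hS, hs⟩⟩

lemma card_of_mem_oddLabels {S : Finset (Fin d)} {a : Fin n} (hS : S ∈ L.oddLabels a) :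
    S.card = k := by
  rw [mem_oddLabels] at hS
  by_contra hk
  apply hS
  have : L.stepsLabeled S = ∅ := by
    simp only [stepsLabeled, Finset.filter_eq_empty_iff, Finset.mem_univ, true_implies]
    rintro s rfl
    exact hk (card_label s)
  simp [this, stepDegree]

lemma exists_ne_mem_oddLabels {S : Finset (Fin d)} {a : Fin n} (hS : S ∈ L.oddLabels a)
    {j : Fin d} (hj : j ∈ S) : ∃ S' ∈ L.oddLabels a, S' ≠ S ∧ j ∈ S' := by
  by_contra! hcon
  have htot := stepDegree_filter_label (L := L) (Finset.univ.filter fun S => j ∈ S) a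
  rw [← Finset.add_sum_erase _ _ (show S ∈ Finset.univ.filter fun S => j ∈ S by simpa using hj)]
    at htot
  have hrest : Even (∑ S' ∈ (Finset.univ.filter fun S => j ∈ S).erase S,
      stepDegree L.idx (L.stepsLabeled S') a) := by
    refine Finset.even_sum _ fun S' hS' => ?_
    simp only [Finset.mem_erase, Finset.mem_filter, Finset.mem_univ, true_and] at hS'
    by_contra hodd
    exact hcon S' (mem_oddLabels.mpr hodd) hS'.1 hS'.2
  have hall : Even (stepDegree L.idx
      (Finset.univ.filter fun s => L.label s ∈ Finset.univ.filter fun S => j ∈ S) a) := by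
    simpa [stepsThrough] using even_stepDegree_stepsThrough (L := L) j a
  rw [htot, Nat.even_add] at hall
  exact mem_oddLabels.mp hS (hall.mpr hrest)

lemma three_le_card_oddLabels (hk : 1 ≤ k) {a : Fin n} (ha : (L.oddLabels a).Nonempty) :
    3 ≤ (L.oddLabels a).card := by
  obtain ⟨S, hS⟩ := ha
  have hSk := card_of_mem_oddLabels hS
  obtain ⟨j, hj⟩ := Finset.card_pos.mp (by omega : 0 < S.card)
  obtain ⟨S₂, hS₂, hne, -⟩ := exists_ne_mem_oddLabels hS hj
  have hS₂k := card_of_mem_oddLabels hS₂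
  obtain ⟨j₂, hj₂, hj₂S⟩ : ∃ j₂ ∈ S₂, j₂ ∉ S := by
    by_contra! hsub
    exact hne (Finset.eq_of_subset_of_card_le hsub (by omega))
  obtain ⟨S₃, hS₃, hne₃, hj₃⟩ := exists_ne_mem_oddLabels hS₂ hj₂
  have hne' : S₃ ≠ S := by rintro rfl; exact hj₂S hj₃
  have : 2 < (L.oddLabels a).card :=
    Finset.two_lt_card.mpr ⟨S, hS, S₂, hS₂, S₃, hS₃, hne.symm, hne'.symm, hne₃.symm⟩
  exact this

lemma oddLabels_subset_badLabels (a : Fin n) : L.oddLabels a ⊆ L.badLabels :=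
  Finset.subset_biUnion_of_mem L.oddLabels (Finset.mem_univ a)

lemma card_oddLabels_le_stepDegree (a : Fin n) :
    (L.oddLabels a).card ≤ stepDegree L.idx L.badSteps a := by
  rw [badSteps, stepDegree_filter_label, Finset.card_eq_sum_ones]
  refine (Finset.sum_le_sum fun S hS => ?_).trans
    (Finset.sum_le_sum_of_subset (oddLabels_subset_badLabels a))
  rw [mem_oddLabels] at hS
  by_contra h0
  apply hS
  rw [show stepDegree L.idx (L.stepsLabeled S) a = 0 by omega]
  exact Even.zero

lemma two_le_stepDegree_badSteps (hk : 1 ≤ k) {a : Fin n}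
    (ha : 0 < stepDegree L.idx L.badSteps a) : 2 ≤ stepDegree L.idx L.badSteps a := by
  by_cases hne : (L.oddLabels a).Nonempty
  · have h1 := three_le_card_oddLabels hk hne
    have h2 := card_oddLabels_le_stepDegree (L := L) a
    omega
  · have heven : Even (stepDegree L.idx L.badSteps a) := by
      rw [badSteps, stepDegree_filter_label]
      refine Finset.even_sum _ fun S _ => ?_
      by_contra hS
      exact hne ⟨S, mem_oddLabels.mpr hS⟩
    obtain ⟨m, hm⟩ := heven
    omega

lemma card_badLabels_le (hk : 1 ≤ k) :
    L.badLabels.card ≤ 6 * (L.badSteps \ treeSteps L.idx).card := by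
  set V := Finset.univ.filter fun a => 0 < stepDegree L.idx L.badSteps a with hV
  have hdeg : ∑ a ∈ V, stepDegree L.idx L.badSteps a = 2 * L.badSteps.card := by
    rw [← sum_stepDegree (idx := L.idx) L.badSteps, hV]
    refine Finset.sum_subset (Finset.subset_univ _) fun a _ ha => ?_
    simpa using ha
  have hcard : L.badLabels.card ≤ ∑ a ∈ V, (L.oddLabels a).card := by
    refine Finset.card_biUnion_le.trans (le_of_eq (Finset.sum_subset (Finset.subset_univ _)
      fun a _ ha => ?_).symm)
    have h1 := card_oddLabels_le_stepDegree (L := L) a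
    have h2 : stepDegree L.idx L.badSteps a = 0 := by simpa [hV] using ha
    omega
  have hlocal : ∀ a ∈ V, (L.oddLabels a).card + 6 ≤ 3 * stepDegree L.idx L.badSteps a := by
    intro a ha
    have h1 := card_oddLabels_le_stepDegree (L := L) a
    have h2 := two_le_stepDegree_badSteps hk (show 0 < stepDegree L.idx L.badSteps a by
      simpa [hV] using ha)
    rcases (L.oddLabels a).eq_empty_or_nonempty with he | hne
    · rw [he, Finset.card_empty]
      omega
    · have := three_le_card_oddLabels hk hne
      omega
  have hsum := Finset.sum_le_sum hlocal
  rw [Finset.sum_add_distrib, ← Finset.mul_sum, hdeg, Finset.sum_const, smul_eq_mul] at hsum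
  have hsupp := card_le_card_support_add (idx := L.idx) L.badSteps
  rw [← hV] at hsupp
  omega

lemma exists_two_le_card_of_bad (hk : 1 ≤ k) {f : ZMod h}
    (hf : f ∈ L.badSteps \ treeSteps L.idx) :
    ∃ j ∈ L.label f, 2 ≤ (L.stepsThrough j \ treeSteps L.idx).card := by
  rw [Finset.mem_sdiff] at hf
  obtain ⟨hbad, hfT⟩ := hf
  by_contra! hcon
  have hsingle : ∀ j ∈ L.label f, L.stepsThrough j \ treeSteps L.idx = {f} := by
    intro j hj
    have hmem : f ∈ L.stepsThrough j \ treeSteps L.idx := by simp [stepsThrough, hj, hfT]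
    have hlt := hcon j hj
    exact (Finset.eq_of_subset_of_card_le (Finset.singleton_subset_iff.mpr hmem)
      (by rw [Finset.card_singleton]; omega)).symm
  obtain ⟨j, hj⟩ := Finset.card_pos.mp (by rw [card_label]; omega : 0 < (L.label f).card)
  have heq : ∀ j' ∈ L.label f, L.stepsThrough j = L.stepsThrough j' := fun j' hj' =>
    eq_of_sdiff_treeSteps_eq (even_stepDegree_stepsThrough j) (even_stepDegree_stepsThrough j')
      ((hsingle j hj).trans (hsingle j' hj').symm)
  have hlab : L.stepsLabeled (L.label f) = L.stepsThrough j := by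
    ext t
    constructor
    · intro ht
      simp only [stepsLabeled, Finset.mem_filter, Finset.mem_univ, true_and] at ht
      simpa [stepsThrough, ht] using hj
    · intro ht
      have hsub : L.label f ⊆ L.label t := fun j' hj' => by
        rw [heq j' hj'] at ht
        simpa [stepsThrough] using ht
      simpa [stepsLabeled] using
        (Finset.eq_of_subset_of_card_le hsub (by rw [card_label, card_label])).symm
  simp only [badSteps, badLabels, Finset.mem_filter, Finset.mem_univ, true_and,
    Finset.mem_biUnion, mem_oddLabels, hlab] at hbad
  obtain ⟨a, ha⟩ := hbad
  exact ha (even_stepDegree_stepsThrough j a)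

lemma card_sdiff_treeSteps_pos {j : Fin d} (hj : j ∈ Finset.univ.biUnion L.label) :
    0 < (L.stepsThrough j \ treeSteps L.idx).card := by
  rw [Finset.card_pos, Finset.sdiff_nonempty]
  intro hsub
  have hempty := eq_empty_of_subset_treeSteps (even_stepDegree_stepsThrough j) hsub
  obtain ⟨s, -, hs⟩ := Finset.mem_biUnion.mp hj
  have : s ∈ L.stepsThrough j := by simpa [stepsThrough] using hs
  simp [hempty] at this

lemma sum_card_sdiff_treeSteps :
    ∑ j ∈ Finset.univ.biUnion L.label, (L.stepsThrough j \ treeSteps L.idx).card =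
      k * (h - (treeSteps L.idx).card) := by
  have hcompl : ((treeSteps L.idx)ᶜ).card = h - (treeSteps L.idx).card := by
    rw [Finset.card_compl, ZMod.card]
  have h1 : ∀ j, L.stepsThrough j \ treeSteps L.idx =
      (treeSteps L.idx)ᶜ.filter fun s => j ∈ L.label s := by
    intro j
    ext s
    simp [stepsThrough, and_comm]
  simp_rw [h1]
  rw [← hcompl, mul_comm, ← smul_eq_mul, ← Finset.sum_const]
  have := Finset.sum_card_bipartiteAbove_eq_sum_card_bipartiteBelow
    (s := Finset.univ.biUnion L.label) (t := (treeSteps L.idx)ᶜ) (fun j s => j ∈ L.label s)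
  simp only [Finset.bipartiteAbove, Finset.bipartiteBelow] at this
  rw [this]
  refine Finset.sum_congr rfl fun s _ => ?_
  rw [Finset.filter_mem_eq_inter, Finset.inter_eq_right.mpr
    (Finset.subset_biUnion_of_mem L.label (Finset.mem_univ s)), card_label]

lemma card_badSteps_sdiff_le (hk : 1 ≤ k) :
    ((L.badSteps \ treeSteps L.idx).card : ℤ) ≤ 2 * Δlab L := by
  set occ := Finset.univ.biUnion L.label with hocc
  set c := fun j => (L.stepsThrough j \ treeSteps L.idx).card with hc
  have hcover : L.badSteps \ treeSteps L.idx ⊆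
      (occ.filter fun j => 2 ≤ c j).biUnion fun j => L.stepsThrough j \ treeSteps L.idx := by
    intro f hf
    obtain ⟨j, hj, hj2⟩ := exists_two_le_card_of_bad hk hf
    refine Finset.mem_biUnion.mpr ⟨j, Finset.mem_filter.mpr
      ⟨Finset.mem_biUnion.mpr ⟨f, Finset.mem_univ _, hj⟩, hj2⟩, ?_⟩
    simp [stepsThrough, hj, (Finset.mem_sdiff.mp hf).2]
  have hle : (L.badSteps \ treeSteps L.idx).card + 2 * occ.card ≤ 2 * ∑ j ∈ occ, c j := by
    have h1 := (Finset.card_le_card hcover).trans Finset.card_biUnion_le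
    rw [Finset.sum_filter] at h1
    change _ ≤ ∑ j ∈ occ, if 2 ≤ c j then c j else 0 at h1
    have h2 : ∑ j ∈ occ, ((if 2 ≤ c j then c j else 0) + 2) ≤ ∑ j ∈ occ, 2 * c j := by
      refine Finset.sum_le_sum fun j hj => ?_
      have := card_sdiff_treeSteps_pos hj
      change 0 < c j at this
      split_ifs <;> omega
    rw [Finset.sum_add_distrib, Finset.sum_const, smul_eq_mul, ← Finset.mul_sum] at h2
    omega
  rw [sum_card_sdiff_treeSteps] at hle
  have hT : (treeSteps L.idx).card ≤ h := by
    simpa [ZMod.card] using Finset.card_le_univ (treeSteps L.idx)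
  have hrn : rn L ≤ (treeSteps L.idx).card + 1 := card_image_le_card_treeSteps
  have hrd : rd L = occ.card := rfl
  unfold Δlab
  rw [hrd]
  zify [hT] at hle hrn
  nlinarith [mul_le_mul_of_nonneg_left hrn (Int.natCast_nonneg k)]

end MultiLabeling

/-- For `2 ≤ h ≤ d`, the number of bad occurring unordered `d`-vertex labels — `k`-element
subsets `S = range(J_s)` for some `s` such that for some `n`-label `a` the number of edges
between `a` and `S` is odd — is at most `48 Δ`. -/
theorem multiLabeling_bad_unordered_label_bound
    (hh : 2 ≤ h) (hk : 1 ≤ k) (hn : 2 ≤ n) (hd : k ≤ d) (hhd : h ≤ d)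
    (L : MultiLabeling h k n d) :
    (Set.ncard {S : Finset (Fin d) | S.card = k ∧
        (∃ s : ZMod h, Finset.image (L.lbl s) Finset.univ = S) ∧
        ∃ a : Fin n, ¬ Even (unorderedLabelEdgeCount L S a)} : ℤ) ≤
      48 * Δlab L := by
  have hsub : {S : Finset (Fin d) | S.card = k ∧
      (∃ s : ZMod h, Finset.image (L.lbl s) Finset.univ = S) ∧
      ∃ a : Fin n, ¬ Even (unorderedLabelEdgeCount L S a)} ⊆ (L.badLabels : Set _) := by
    rintro S ⟨-, -, a, ha⟩
    rw [MultiLabeling.unorderedLabelEdgeCount_eq] at ha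
    exact MultiLabeling.oddLabels_subset_badLabels a (MultiLabeling.mem_oddLabels.mpr ha)
  have h1 := Set.ncard_le_ncard hsub (Finset.finite_toSet _)
  rw [Set.ncard_coe_finset] at h1
  have h2 := MultiLabeling.card_badLabels_le (L := L) hk
  have h3 := MultiLabeling.card_badSteps_sdiff_le (L := L) hk
  omega

end
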